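/- arXiv:2109.10002 — 3 statements merged into one kernel-verified Lean document; each statement's English description precedes it below -/
import Mathlib

section
/- Van der Aalst's theorem: every perpetual free-choice system is lucent. That is, if (N,μ₀) is a live and bounded free-choice system possessing a cluster cl of N such that μ_cl is a home marking, then any two reachable markings μ₁, μ₂ of (N,μ₀) with en(N,μ₁) = en(N,μ₂) satisfy μ₁ = μ₂. -/
open Classical

/-- A (finite, bipartite) Petri *net*: disjoint finite sets of places and
transitions, and an edge relation running only between places and transitions. -/
structure Net (α : Type*) where
  places : Finset α
  transitions : Finset α
  F : α → α → Prop
  disj : Disjoint places transitions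
  edges : ∀ x y, F x y →
    (x ∈ places ∧ y ∈ transitions) ∨ (x ∈ transitions ∧ y ∈ places)

namespace Net

variable {α : Type*} [DecidableEq α]

/-- The nodes of a net. -/
def nodes (N : Net α) : Finset α := N.places ∪ N.transitions

/-- Pre-set of a node. -/
def pre (N : Net α) (x : α) : Set α := {y | N.F y x}

/-- Post-set of a node. -/
def post (N : Net α) (x : α) : Set α := {y | N.F x y}

/-- A transition `t` is enabled at a marking `μ` if every pre-place is marked. -/
def Enabled (N : Net α) (μ : α → ℕ) (t : α) : Prop :=
  t ∈ N.transitions ∧ ∀ p, N.F p t → 1 ≤ μ p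

/-- Firing a transition: remove one token from each pre-place,
add one token at each post-place. -/
noncomputable def fire (N : Net α) (t : α) (μ : α → ℕ) : α → ℕ :=
  fun p => μ p - (if N.F p t then 1 else 0) + (if N.F t p then 1 else 0)

/-- `FireSeq N μ σ ν`: the occurrence sequence `σ` is enabled at `μ` and
firing it successively leads from `μ` to `ν`. -/
inductive FireSeq (N : Net α) : (α → ℕ) → List α → (α → ℕ) → Prop
  | nil (μ : α → ℕ) : FireSeq N μ [] μ
  | cons {μ ν : α → ℕ} {t : α} {σ : List α} :
      N.Enabled μ t → FireSeq N (N.fire t μ) σ ν → FireSeq N μ (t :: σ) ν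

/-- Reachability of markings. -/
def Reach (N : Net α) (μ ν : α → ℕ) : Prop := ∃ σ : List α, N.FireSeq μ σ ν

/-- The set of transitions enabled at `μ`. -/
def en (N : Net α) (μ : α → ℕ) : Set α := {t | N.Enabled μ t}

/-- Equality of markings (as maps on the places of the net). -/
def MarkingEq (N : Net α) (μ ν : α → ℕ) : Prop := ∀ p ∈ N.places, μ p = ν p

/-- Liveness of a Petri net `(N, μ₀)`. -/
def Live (N : Net α) (μ₀ : α → ℕ) : Prop :=
  ∀ t ∈ N.transitions, ∀ μ, N.Reach μ₀ μ → ∃ ν, N.Reach μ ν ∧ N.Enabled ν t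

/-- Boundedness of a Petri net `(N, μ₀)`. -/
def Bounded (N : Net α) (μ₀ : α → ℕ) : Prop :=
  ∃ K : ℕ, ∀ μ, N.Reach μ₀ μ → ∀ p ∈ N.places, μ p ≤ K

/-- A net is well-formed if it carries a live and bounded marking. -/
def WellFormed (N : Net α) : Prop := ∃ μ₀ : α → ℕ, N.Live μ₀ ∧ N.Bounded μ₀

/-- Free-choice net: `(p,t) ∈ F` implies `•t × p• ⊆ F`. -/
def FreeChoice (N : Net α) : Prop :=
  ∀ p ∈ N.places, ∀ t, N.F p t → ∀ p', N.F p' t → ∀ t', N.F p t' → N.F p' t'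

/-- T-net: every place has exactly one pre-transition and one post-transition. -/
def IsTNet (N : Net α) : Prop :=
  ∀ p ∈ N.places, (∃! t, N.F t p) ∧ (∃! t, N.F p t)

/-- A set of nodes is cluster-closed if with each place it contains the
post-set of the place and with each transition the pre-set of the transition. -/
def ClusterClosed (N : Net α) (S : Set α) : Prop :=
  (∀ p ∈ S, p ∈ N.places → ∀ t, N.F p t → t ∈ S) ∧
  (∀ t ∈ S, t ∈ N.transitions → ∀ p, N.F p t → p ∈ S)

/-- The cluster of a node: the smallest cluster-closed set of nodes containing it. -/
def clusterOf (N : Net α) (x : α) : Set α :=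
  ⋂₀ {S : Set α | x ∈ S ∧ N.ClusterClosed S}

/-- `cl` is a cluster of `N` if it is the cluster of some node. -/
def IsCluster (N : Net α) (cl : Set α) : Prop :=
  ∃ x ∈ N.nodes, cl = N.clusterOf x

/-- The marking `μ_cl` marking exactly the places of the cluster `cl`, once. -/
noncomputable def clusterMarking (N : Net α) (cl : Set α) : α → ℕ :=
  fun p => if p ∈ cl ∧ p ∈ N.places then 1 else 0

/-- `μh` is a home marking of `(N, μ₀)`: reachable from every reachable marking. -/
def IsHomeMarking (N : Net α) (μ₀ μh : α → ℕ) : Prop :=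
  ∀ μ, N.Reach μ₀ μ → ∃ ν, N.Reach μ ν ∧ N.MarkingEq ν μh

/-- `(N, μ₀)` is perpetual with regeneration cluster `cl`: live, bounded, and
`μ_cl` is a home marking for the cluster `cl`. -/
def Perpetual (N : Net α) (μ₀ : α → ℕ) (cl : Set α) : Prop :=
  N.Live μ₀ ∧ N.Bounded μ₀ ∧ N.IsCluster cl ∧
    N.IsHomeMarking μ₀ (N.clusterMarking cl)

/-- Lucency: enabling-equivalent reachable markings are equal. -/
def Lucent (N : Net α) (μ₀ : α → ℕ) : Prop :=
  ∀ μ₁ μ₂, N.Reach μ₀ μ₁ → N.Reach μ₀ μ₂ → N.en μ₁ = N.en μ₂ → N.MarkingEq μ₁ μ₂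

/-- A path of the net: a nonempty sequence of nodes along edges. -/
def IsPath (N : Net α) (δ : List α) : Prop :=
  δ ≠ [] ∧ (∀ x ∈ δ, x ∈ N.nodes) ∧ δ.Chain' N.F

/-- A circuit: a path whose last node is connected back to its first node. -/
def IsCircuit (N : Net α) (δ : List α) : Prop :=
  N.IsPath δ ∧ ∃ h : δ ≠ [], N.F (δ.getLast h) (δ.head h)

/-- Token count of a set of nodes: total number of tokens on its places. -/
def tokenCount (N : Net α) (μ : α → ℕ) (X : Finset α) : ℕ :=
  ∑ p ∈ X ∩ N.places, μ p

/-- The set `S` of nodes is strongly connected (in the induced subnet). -/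
def StronglyConnectedOn (N : Net α) (S : Finset α) : Prop :=
  ∀ x ∈ S, ∀ y ∈ S,
    Relation.ReflTransGen (fun a b => a ∈ S ∧ b ∈ S ∧ N.F a b) x y

/-- The set `S` of nodes is weakly connected (in the induced subnet). -/
def WeaklyConnectedOn (N : Net α) (S : Finset α) : Prop :=
  ∀ x ∈ S, ∀ y ∈ S,
    Relation.ReflTransGen (fun a b => a ∈ S ∧ b ∈ S ∧ (N.F a b ∨ N.F b a)) x y

/-- The (full) subnet spanned by `S` is transition-bordered: every place of `S`
has all its neighbours inside `S`. -/
def TransitionBordered (N : Net α) (S : Finset α) : Prop :=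
  ∀ p ∈ S, p ∈ N.places → ∀ y, (N.F y p ∨ N.F p y) → y ∈ S

/-- The full subnet spanned by `S` is a T-net: each place of `S` has exactly one
pre-transition and one post-transition inside `S`. -/
def TNetOn (N : Net α) (S : Finset α) : Prop :=
  ∀ p ∈ S, p ∈ N.places →
    (∃! t, t ∈ S ∧ N.F t p) ∧ (∃! t, t ∈ S ∧ N.F p t)

/-- `S` spans a CP-subnet of `N`: nonempty, weakly connected, transition-bordered,
a T-net, and the complement contains a transition and is strongly connected. -/
def IsCPSubnet (N : Net α) (S : Finset α) : Prop :=
  S.Nonempty ∧ S ⊆ N.nodes ∧ N.WeaklyConnectedOn S ∧ N.TransitionBordered S ∧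
  N.TNetOn S ∧ ((N.nodes \ S) ∩ N.transitions).Nonempty ∧
  N.StronglyConnectedOn (N.nodes \ S)

/-- The full subnet of `N` spanned by the node set `S`, as a net. -/
def restrict (N : Net α) (S : Finset α) : Net α where
  places := N.places ∩ S
  transitions := N.transitions ∩ S
  F := fun x y => x ∈ S ∧ y ∈ S ∧ N.F x y
  disj := N.disj.mono Finset.inter_subset_left Finset.inter_subset_left
  edges := by
    rintro x y ⟨hx, hy, hF⟩
    rcases N.edges x y hF with ⟨h1, h2⟩ | ⟨h1, h2⟩
    · exact Or.inl ⟨Finset.mem_inter.mpr ⟨h1, hx⟩, Finset.mem_inter.mpr ⟨h2, hy⟩⟩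
    · exact Or.inr ⟨Finset.mem_inter.mpr ⟨h1, hx⟩, Finset.mem_inter.mpr ⟨h2, hy⟩⟩

/-- A CP-exhaustion: a family of pairwise disjoint CP-subnets whose complement
is a strongly connected T-net. -/
def IsCPExhaustion (N : Net α) {n : ℕ}
    (Nhat : Fin n → Finset α) : Prop :=
  (∀ i, N.IsCPSubnet (Nhat i)) ∧
  (∀ i j, i ≠ j → Disjoint (Nhat i) (Nhat j)) ∧
  N.StronglyConnectedOn (N.nodes \ Finset.univ.biUnion Nhat) ∧
  N.TNetOn (N.nodes \ Finset.univ.biUnion Nhat)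

/-- `t` is a way-in transition of the subnet spanned by `S`: a transition of `S`
with a pre-place outside `S`. -/
def IsWayIn (N : Net α) (S : Finset α) (t : α) : Prop :=
  t ∈ S ∧ t ∈ N.transitions ∧ ∃ p ∈ N.places, p ∉ S ∧ N.F p t

/-- A shutdown sequence for the subnet spanned by `S` (with way-in transition
`tin`) at a marking `μ`: an occurrence sequence enabled at `μ` using only
transitions of `S` other than `tin`, after which no transition of `S` other
than (possibly) `tin` is enabled. -/
def IsShutdownSeq (N : Net α) (S : Finset α) (tin : α)
    (μ : α → ℕ) (σ : List α) (μsd : α → ℕ) : Prop :=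
  N.FireSeq μ σ μsd ∧
  (∀ t ∈ σ, t ∈ S ∧ t ∈ N.transitions ∧ t ≠ tin) ∧
  (∀ t ∈ S, t ∈ N.transitions → t ≠ tin → ¬ N.Enabled μsd t)

/-- `C` spans a P-component of `N`: nonempty, strongly connected, inside `C`
every transition has exactly one pre-place and one post-place, and every place
of `C` has all its neighbours inside `C`. -/
def IsPComponent (N : Net α) (C : Finset α) : Prop :=
  C.Nonempty ∧ C ⊆ N.nodes ∧ N.StronglyConnectedOn C ∧
  (∀ t ∈ C, t ∈ N.transitions →
    (∃! p, p ∈ C ∧ N.F p t) ∧ (∃! p, p ∈ C ∧ N.F t p)) ∧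
  (∀ p ∈ C, p ∈ N.places → ∀ y, (N.F y p ∨ N.F p y) → y ∈ C)

end Net

namespace Net

section Firing

variable {α : Type*} {N : Net α} {μ ν ξ : α → ℕ} {σ τ : List α} {p t : α}

lemma F_place_left (h : N.F p t) (ht : t ∈ N.transitions) : p ∈ N.places := by
  rcases N.edges _ _ h with h | h
  · exact h.1
  · exact absurd ht (Finset.disjoint_left.mp N.disj h.2)

lemma F_place_right (h : N.F t p) (ht : t ∈ N.transitions) : p ∈ N.places := by
  rcases N.edges _ _ h with h | h
  · exact absurd ht (Finset.disjoint_left.mp N.disj h.1)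
  · exact h.2

lemma F_transition_right (h : N.F p t) (hp : p ∈ N.places) : t ∈ N.transitions := by
  rcases N.edges _ _ h with h | h
  · exact h.2
  · exact absurd h.1 (Finset.disjoint_left.mp N.disj hp)

lemma F_transition_left (h : N.F t p) (hp : p ∈ N.places) : t ∈ N.transitions := by
  rcases N.edges _ _ h with h | h
  · exact absurd h.2 (Finset.disjoint_left.mp N.disj hp)
  · exact h.1

/-- Marking equation for a single firing, without subtraction. -/
lemma Enabled.fire_add (h : N.Enabled μ t) (p : α) :
    N.fire t μ p + (if N.F p t then 1 else 0) = μ p + (if N.F t p then 1 else 0) := by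
  have := h.2 p
  unfold fire
  by_cases hp : N.F p t
  · have := this hp
    simp only [hp, if_true]
    omega
  · simp [hp]

lemma FireSeq.mem_transitions (h : N.FireSeq μ σ ν) : ∀ t ∈ σ, t ∈ N.transitions := by
  induction h with
  | nil => simp
  | cons he _ ih => exact List.forall_mem_cons.mpr ⟨he.1, ih⟩

/-- Marking equation for an occurrence sequence, without subtraction. -/
lemma FireSeq.add_countP (h : N.FireSeq μ σ ν) (p : α) :
    ν p + σ.countP (fun t => N.F p t) = μ p + σ.countP (fun t => N.F t p) := by
  induction h with
  | nil => simp
  | @cons μ ν t σ he _ ih =>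
    have := he.fire_add p
    simp only [List.countP_cons, decide_eq_true_eq]
    omega

lemma FireSeq.append (h : N.FireSeq μ σ ν) (h' : N.FireSeq ν τ ξ) :
    N.FireSeq μ (σ ++ τ) ξ := by
  induction h with
  | nil => exact h'
  | cons he _ ih => exact .cons he (ih h')

lemma FireSeq.exists_of_append (h : N.FireSeq μ (σ ++ τ) ξ) :
    ∃ ν, N.FireSeq μ σ ν ∧ N.FireSeq ν τ ξ := by
  induction σ generalizing μ with
  | nil => exact ⟨μ, .nil μ, h⟩
  | cons t σ ih =>
    cases h with
    | cons he hs =>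
      obtain ⟨ν, h1, h2⟩ := ih hs
      exact ⟨ν, .cons he h1, h2⟩

lemma Reach.refl (μ : α → ℕ) : N.Reach μ μ := ⟨[], .nil μ⟩

lemma Reach.trans (h : N.Reach μ ν) (h' : N.Reach ν ξ) : N.Reach μ ξ := by
  obtain ⟨σ, hσ⟩ := h
  obtain ⟨τ, hτ⟩ := h'
  exact ⟨σ ++ τ, hσ.append hτ⟩

lemma Enabled.reach_fire (h : N.Enabled μ t) : N.Reach μ (N.fire t μ) :=
  ⟨[t], .cons h (.nil _)⟩

/-- Occurrence sequences remain enabled when tokens are added. -/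
lemma FireSeq.add_right (h : N.FireSeq μ σ ν) (δ : α → ℕ) :
    N.FireSeq (μ + δ) σ (ν + δ) := by
  induction h with
  | nil => exact .nil _
  | @cons μ ν t σ he _ ih =>
    have he' : N.Enabled (μ + δ) t := ⟨he.1, fun p hp => le_add_right (he.2 p hp)⟩
    refine .cons he' ?_
    convert ih using 1
    funext p
    have h1 := he.fire_add p
    have h2 := he'.fire_add p
    simp only [Pi.add_apply] at *
    omega

lemma FireSeq.apply_eq_of_notMem (h : N.FireSeq μ σ ν) (hp : p ∉ N.places) : ν p = μ p := by
  have h1 := h.add_countP p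
  have h2 : σ.countP (fun t => N.F p t) = 0 := by
    simp only [List.countP_eq_zero, decide_eq_true_eq]
    exact fun t ht hF => hp (F_place_left hF (h.mem_transitions t ht))
  have h3 : σ.countP (fun t => N.F t p) = 0 := by
    simp only [List.countP_eq_zero, decide_eq_true_eq]
    exact fun t ht hF => hp (F_place_right hF (h.mem_transitions t ht))
  omega

/-- In a bounded system no marking strictly covers one from which it is reachable. -/
lemma Bounded.eq_of_le {μ₀ : α → ℕ} (hb : N.Bounded μ₀) (hμ : N.Reach μ₀ μ)
    (hν : N.Reach μ ν) (hle : μ ≤ ν) : ν = μ := by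
  obtain ⟨δ, rfl⟩ : ∃ δ, ν = μ + δ := ⟨ν - μ, (add_tsub_cancel_of_le hle).symm⟩
  obtain ⟨σ, hσ⟩ := hν
  obtain ⟨K, hK⟩ := hb
  have pump : ∀ n : ℕ, N.Reach μ (μ + n • δ) := by
    intro n
    induction n with
    | zero => simpa using Reach.refl μ
    | succ n ih =>
      refine ih.trans ⟨σ, ?_⟩
      have := hσ.add_right (n • δ)
      rwa [add_assoc, ← succ_nsmul'] at this
  funext p
  by_cases hp : p ∈ N.places
  · have := hK _ (hμ.trans (pump (K + 1))) p hp
    simp only [Pi.add_apply, Pi.smul_apply, smul_eq_mul] at this ⊢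
    rcases Nat.eq_zero_or_pos (δ p) with h | h
    · omega
    · nlinarith
  · exact hσ.apply_eq_of_notMem hp

/-- A siphon without tokens along an occurrence sequence stays without tokens,
and no transition of the sequence takes a token from it. -/
lemma FireSeq.siphon {Y : Set α} (h : N.FireSeq μ σ ν)
    (hY : ∀ t ∈ σ, ∀ p ∈ Y, N.F t p → ∃ q ∈ Y, N.F q t) (h0 : ∀ p ∈ Y, μ p = 0) :
    (∀ p ∈ Y, ν p = 0) ∧ ∀ t ∈ σ, ∀ p ∈ Y, ¬ N.F p t := by
  induction h with
  | nil => exact ⟨h0, by simp⟩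
  | @cons μ ν t σ he _ ih =>
    have hin : ∀ p ∈ Y, ¬ N.F p t := fun p hp hF => by
      have := he.2 p hF
      have := h0 p hp
      omega
    have hout : ∀ p ∈ Y, ¬ N.F t p := fun p hp hF => by
      obtain ⟨q, hq, hqt⟩ := hY t (by simp) p hp hF
      exact hin q hq hqt
    have := ih (fun u hu => hY u (by simp [hu])) (fun p hp => by
      have := he.fire_add p
      simp only [hin p hp, hout p hp, if_false, h0 p hp] at this
      omega)
    exact ⟨this.1, List.forall_mem_cons.mpr ⟨hin, this.2⟩⟩

/-- Transitions outside a set that is closed under predecessors can be dropped from an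
occurrence sequence. -/
lemma FireSeq.filter {Z : Set α} (hZ : ∀ x y, N.F x y → y ∈ Z → x ∈ Z)
    (h : N.FireSeq μ σ ν) (ξ : α → ℕ) (hξ : ∀ p ∈ Z, μ p ≤ ξ p) :
    ∃ ξ', N.FireSeq ξ (σ.filter (· ∈ Z)) ξ' ∧ ∀ p ∈ Z, ν p ≤ ξ' p := by
  induction h generalizing ξ with
  | nil => exact ⟨ξ, .nil ξ, hξ⟩
  | @cons μ ν t σ he _ ih =>
    by_cases ht : t ∈ Z
    · have he' : N.Enabled ξ t :=
        ⟨he.1, fun p hp => (he.2 p hp).trans (hξ p (hZ p t hp ht))⟩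
      obtain ⟨ξ', h1, h2⟩ := ih (N.fire t ξ) (fun p hp => by
        have h1 := he.fire_add p
        have h2 := he'.fire_add p
        have := hξ p hp
        omega)
      refine ⟨ξ', ?_, h2⟩
      simpa [ht] using FireSeq.cons he' h1
    · obtain ⟨ξ', h1, h2⟩ := ih ξ (fun p hp => by
        have h1 := he.fire_add p
        have h2 : ¬ N.F t p := fun hF => ht (hZ t p hF hp)
        have := hξ p hp
        simp only [h2, if_false] at h1
        omega)
      refine ⟨ξ', ?_, h2⟩
      simpa [ht] using h1

/-- The weighted number of tokens on the places of the net. -/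
def weight (N : Net α) (w μ : α → ℕ) : ℕ := ∑ p ∈ N.places, w p * μ p

lemma Enabled.weight_fire_add (h : N.Enabled μ t) (w : α → ℕ) :
    N.weight w (N.fire t μ) + N.weight w (fun p => if N.F p t then 1 else 0) =
      N.weight w μ + N.weight w (fun p => if N.F t p then 1 else 0) := by
  unfold weight
  rw [← Finset.sum_add_distrib, ← Finset.sum_add_distrib]
  refine Finset.sum_congr rfl fun p _ => ?_
  rw [← mul_add, ← mul_add, h.fire_add p]

lemma FireSeq.weight_le (w : α → ℕ) (hσ : N.FireSeq μ σ ν)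
    (hw : ∀ t ∈ σ, N.weight w (fun p => if N.F p t then 1 else 0) ≤
      N.weight w (fun p => if N.F t p then 1 else 0)) : N.weight w μ ≤ N.weight w ν := by
  induction hσ with
  | nil => exact le_rfl
  | @cons μ ν t σ he _ ih =>
    have h1 := he.weight_fire_add w
    have h2 := hw t (by simp)
    have h3 := ih fun u hu => hw u (by simp [hu])
    omega

lemma FireSeq.weight_eq (w : α → ℕ) (hσ : N.FireSeq μ σ ν)
    (hw : ∀ t ∈ N.transitions, N.weight w (fun p => if N.F p t then 1 else 0) =
      N.weight w (fun p => if N.F t p then 1 else 0)) : N.weight w μ = N.weight w ν := by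
  induction hσ with
  | nil => rfl
  | @cons μ ν t σ he _ ih =>
    have h1 := he.weight_fire_add w
    have h2 := hw t he.1
    omega

/-- If every transition of `A` increases a weight, then in a bounded system the transitions of
`A` can be fired until none of them is enabled. -/
lemma Bounded.exists_blocked {μ₀ : α → ℕ} (hb : N.Bounded μ₀) (A : Set α) (w : α → ℕ)
    (hw : ∀ t ∈ A, N.weight w (fun p => if N.F p t then 1 else 0) <
      N.weight w (fun p => if N.F t p then 1 else 0)) (hμ : N.Reach μ₀ μ) :
    ∃ σ ν, N.FireSeq μ σ ν ∧ (∀ t ∈ σ, t ∈ A) ∧ ∀ t ∈ A, ¬ N.Enabled ν t := by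
  obtain ⟨K, hK⟩ := hb
  have hbound : ∀ ν, N.Reach μ₀ ν → N.weight w ν ≤ ∑ p ∈ N.places, w p * K := fun ν hν =>
    Finset.sum_le_sum fun p hp => Nat.mul_le_mul_left _ (hK ν hν p hp)
  generalize hn : ∑ p ∈ N.places, w p * K - N.weight w μ = n
  induction n using Nat.strong_induction_on generalizing μ with
  | _ n ih =>
    by_cases hA : ∃ t ∈ A, N.Enabled μ t
    · obtain ⟨t, htA, ht⟩ := hA
      have h1 := ht.weight_fire_add w
      have h2 := hw t htA
      have hr := hμ.trans ht.reach_fire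
      have h3 := hbound _ hr
      obtain ⟨σ, ν, hσ, hσA, hν⟩ := ih _ (by omega) hr rfl
      exact ⟨t :: σ, ν, .cons ht hσ, List.forall_mem_cons.mpr ⟨htA, hσA⟩, hν⟩
    · push Not at hA
      exact ⟨[], μ, .nil μ, by simp, hA⟩

end Firing

/-- `N.DistLE T C n p`: from `p` some place of `C` can be reached by a path that uses at most `n`
transitions, all of them in `T`. -/
def DistLE {α : Type*} (N : Net α) (T C : Set α) : ℕ → α → Prop
  | 0, p => p ∈ C
  | n + 1, p => p ∈ C ∨ ∃ t ∈ T, N.F p t ∧ ∃ q, N.F t q ∧ N.DistLE T C n q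

/-- The least number of transitions on a path from `p` to `C` with transitions in `T`. -/
noncomputable def dist {α : Type*} (N : Net α) (T C : Set α) (p : α) : ℕ :=
  sInf {n | N.DistLE T C n p}

section Distance

variable {α : Type*} {N : Net α} {C : Set α}

lemma exists_closer {T : Set α} {p : α} (hp : ∃ n, N.DistLE T C n p) (hpC : p ∉ C) :
    ∃ t ∈ T, N.F p t ∧ ∃ q, N.F t q ∧ (∃ n, N.DistLE T C n q) ∧
      N.dist T C q < N.dist T C p := by
  have hmem : N.DistLE T C (N.dist T C p) p := Nat.sInf_mem hp
  cases hd : N.dist T C p with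
  | zero => rw [hd] at hmem; exact absurd hmem hpC
  | succ m =>
    rw [hd] at hmem
    rcases hmem with hmem | ⟨t, ht, hpt, q, htq, hq⟩
    · exact absurd hmem hpC
    · exact ⟨t, ht, hpt, q, htq, ⟨m, hq⟩, Nat.lt_succ_of_le (Nat.sInf_le hq)⟩

lemma dist_eq_zero {T : Set α} {p : α} (hp : p ∈ C) : N.dist T C p = 0 :=
  Nat.le_zero.mp (Nat.sInf_le (show N.DistLE T C 0 p from hp))

/-- Every place with finite distance starts a path to `C` with strictly decreasing distance. -/
lemma exists_short_path {T : Set α} {p : α} (hp : ∃ n, N.DistLE T C n p) :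
    ∃ L : Set α, p ∈ L ∧ (∀ x ∈ L, N.dist T C x ≤ N.dist T C p) ∧
      (∀ x ∈ L, ∀ y ∈ L, N.dist T C x = N.dist T C y → x = y) ∧
      ∀ x ∈ L, x ∈ C ∨ ∃ t ∈ T, N.F x t ∧ ∃ q ∈ L, N.F t q ∧
        N.dist T C q < N.dist T C x := by
  generalize hd : N.dist T C p = d
  induction d using Nat.strong_induction_on generalizing p with
  | _ d ih =>
    by_cases hpC : p ∈ C
    · refine ⟨{p}, rfl, ?_, ?_, ?_⟩
      · rintro x rfl
        exact hd.le
      · rintro x rfl y rfl _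
        rfl
      · rintro x rfl
        exact Or.inl hpC
    · obtain ⟨t, ht, hpt, q, htq, hq, hlt⟩ := exists_closer hp hpC
      obtain ⟨L, hqL, hle, hinj, hstep⟩ := ih _ (hd ▸ hlt) hq rfl
      refine ⟨insert p L, Set.mem_insert _ _, ?_, ?_, ?_⟩
      · rintro x (rfl | hx)
        · exact hd.le
        · exact (hle x hx).trans (hd ▸ hlt.le)
      · rintro x (rfl | hx) y (rfl | hy) hxy
        · rfl
        · have := hle y hy
          omega
        · have := hle x hx
          omega
        · exact hinj x hx y hy hxy
      · rintro x (rfl | hx)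
        · exact Or.inr ⟨t, ht, hpt, q, Set.mem_insert_of_mem _ hqL, htq, hlt⟩
        · rcases hstep x hx with hxC | ⟨u, hu, hxu, r, hr, hur, hrx⟩
          · exact Or.inl hxC
          · exact Or.inr ⟨u, hu, hxu, r, Set.mem_insert_of_mem _ hr, hur, hrx⟩

/-- A transition all of whose input places are farther from `C` than one of its output places
increases a suitable weight. -/
lemma exists_weight (N : Net α) (d : α → ℕ) : ∃ w : α → ℕ, ∀ t ∈ N.transitions,
    (∃ p, N.F p t) → (∃ q, N.F t q ∧ ∀ p, N.F p t → d q < d p) →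
    N.weight w (fun p => if N.F p t then 1 else 0) <
      N.weight w (fun p => if N.F t p then 1 else 0) := by
  set D := N.places.sup d
  set b := N.places.card + 1 with hb
  refine ⟨fun p => b ^ (D - d p), ?_⟩
  rintro t ht ⟨p₀, hp₀⟩ ⟨q, hq, hlt⟩
  have hD : d q < D := (hlt p₀ hp₀).trans_le (Finset.le_sup (F_place_left hp₀ ht))
  obtain ⟨e, he⟩ : ∃ e, D - d q = e + 1 := ⟨D - d q - 1, by omega⟩
  calc N.weight (fun p => b ^ (D - d p)) (fun p => if N.F p t then 1 else 0)
      ≤ ∑ p ∈ N.places, b ^ e := by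
        refine Finset.sum_le_sum fun p _ => ?_
        by_cases hF : N.F p t
        · have := hlt p hF
          simp only [hF, if_true, mul_one]
          exact Nat.pow_le_pow_right (Nat.succ_pos _) (by omega)
        · simp [hF]
    _ = N.places.card * b ^ e := by simp
    _ < b ^ (D - d q) := by
        rw [he, pow_succ, mul_comm]
        exact Nat.mul_lt_mul_of_pos_left (Nat.lt_succ_self _) (by positivity)
    _ ≤ N.weight (fun p => b ^ (D - d p)) (fun p => if N.F t p then 1 else 0) := by
        have := Finset.single_le_sum
          (f := fun p => b ^ (D - d p) * (if N.F t p then 1 else 0))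
          (fun _ _ => Nat.zero_le _) (F_place_right hq ht)
        simpa [hq, weight] using this

end Distance

/-- A live and bounded free-choice system with a home marking `h` that marks exactly the places
in `C`, each once, where every transition with an input place in `C` has input set `C`. -/
structure Regenerates {α : Type*} (N : Net α) (μ₀ h : α → ℕ) (C : Set α) :
    Prop where
  freeChoice : N.FreeChoice
  live : N.Live μ₀
  bounded : N.Bounded μ₀
  reach : N.Reach μ₀ h
  home : ∀ μ, N.Reach μ₀ μ → N.Reach μ h
  subset_places : ∀ p ∈ C, p ∈ N.places
  eq_one : ∀ p ∈ C, h p = 1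
  eq_zero : ∀ p ∈ N.places, p ∉ C → h p = 0
  pre_iff : ∀ p ∈ C, ∀ t, N.F p t → ∀ q, N.F q t ↔ q ∈ C

namespace Regenerates

variable {α : Type*} {N : Net α} {μ₀ h μ : α → ℕ} {C : Set α}

lemma pre_congr (R : N.Regenerates μ₀ h C) {p t u : α} (hp : p ∈ N.places) (h1 : N.F p t)
    (h2 : N.F p u) (q : α) : N.F q t ↔ N.F q u :=
  ⟨fun hq => R.freeChoice p hp t h1 q hq u h2, fun hq => R.freeChoice p hp u h2 q hq t h1⟩

lemma le_of_forall_mem (R : N.Regenerates μ₀ h C) (hμ : N.Reach μ₀ μ)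
    (hC : ∀ p ∈ C, 1 ≤ μ p) : h ≤ μ := by
  intro p
  by_cases hp : p ∈ N.places
  · by_cases hpC : p ∈ C
    · rw [R.eq_one p hpC]
      exact hC p hpC
    · rw [R.eq_zero p hp hpC]
      exact Nat.zero_le _
  · obtain ⟨σ, hσ⟩ := R.home μ hμ
    exact (hσ.apply_eq_of_notMem hp).le

/-- A transition without input places has no output places. -/
lemma exists_pre (R : N.Regenerates μ₀ h C) {t p : α} (ht : t ∈ N.transitions) (hF : N.F t p) :
    ∃ q, N.F q t := by
  by_contra! hq
  have he : N.Enabled h t := ⟨ht, fun q hF => absurd hF (hq q)⟩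
  have := R.bounded.eq_of_le R.reach he.reach_fire (fun q => by simp [fire, hq])
  have := congrFun this p
  simp [fire, hq, hF] at this

/-- From the home marking one can fire any transition and return. -/
lemma exists_cycle (R : N.Regenerates μ₀ h C) {t : α} (ht : t ∈ N.transitions) :
    ∃ σ, N.FireSeq h σ h ∧ t ∈ σ := by
  obtain ⟨ν, ⟨σ, hσ⟩, hν⟩ := R.live t ht h R.reach
  obtain ⟨τ, hτ⟩ := R.home _ ((R.reach.trans ⟨σ, hσ⟩).trans hν.reach_fire)
  exact ⟨σ ++ t :: τ, hσ.append (.cons hν hτ), by simp⟩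

/-- Every transition with an input place is connected by a path to `C`. -/
lemma exists_path (R : N.Regenerates μ₀ h C) {t p : α} (ht : t ∈ N.transitions)
    (hp : N.F p t) : ∃ c ∈ C, Relation.ReflTransGen N.F t c := by
  set Z : Set α := {x | ∃ c ∈ C, Relation.ReflTransGen N.F x c} with hZdef
  have hZ : ∀ x y, N.F x y → y ∈ Z → x ∈ Z := by
    rintro x y hF ⟨c, hc, hyc⟩
    exact ⟨c, hc, .head hF hyc⟩
  by_contra htZ
  change t ∉ Z at htZ
  obtain ⟨σ, hσ, htσ⟩ := R.exists_cycle ht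
  obtain ⟨ξ, hξ, hle⟩ := hσ.filter hZ h (fun _ _ => le_rfl)
  have hξh : ξ = h := by
    refine R.bounded.eq_of_le R.reach ⟨_, hξ⟩ (R.le_of_forall_mem (R.reach.trans ⟨_, hξ⟩) ?_)
    intro c hc
    rw [← R.eq_one c hc]
    exact hle c ⟨c, hc, .refl⟩
  subst hξh
  -- transitions in `Z` put no tokens outside `Z`
  have hZout : ∀ u ∈ σ, u ∈ Z → ∀ q, N.F u q → q ∈ Z := by
    intro u huσ huZ q hF
    by_contra hq
    have h1 := hξ.add_countP q
    have h2 : (σ.filter (· ∈ Z)).countP (fun t => N.F q t) = 0 := by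
      simp only [List.countP_eq_zero, decide_eq_true_eq, List.mem_filter]
      exact fun v hv hqv => hq (hZ q v hqv hv.2)
    have h3 : 0 < (σ.filter (· ∈ Z)).countP (fun t => N.F t q) := by
      rw [List.countP_pos_iff]
      exact ⟨u, by simp [huσ, huZ], by simpa using hF⟩
    omega
  -- transitions outside `Z` take no tokens from `Z`
  have hZin : ∀ u ∈ σ, u ∉ Z → ∀ q, N.F q u → q ∉ Z := by
    intro u huσ huZ q hF hq
    have h1 := hξ.add_countP q
    have h2 := hσ.add_countP q
    have h3 : σ.countP (fun t => N.F t q) = (σ.filter (· ∈ Z)).countP (fun t => N.F t q) := by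
      rw [List.countP_filter]
      refine List.countP_congr fun v _ => ?_
      simp only [decide_eq_true_eq, Bool.and_eq_true]
      exact ⟨fun hv => ⟨hv, hZ v q hv hq⟩, fun hv => hv.1⟩
    have h4 : σ.countP (fun t => N.F q t) =
        (σ.filter (· ∈ Z)).countP (fun t => N.F q t) +
          (σ.filter (fun v => ¬ v ∈ Z)).countP (fun t => N.F q t) := by
      have := List.countP_eq_countP_filter_add σ (fun t => decide (N.F q t))
        (fun v => decide (v ∈ Z))
      simpa using this
    have h5 : 0 < (σ.filter (fun v => ¬ v ∈ Z)).countP (fun t => N.F q t) := by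
      rw [List.countP_pos_iff]
      exact ⟨u, by simp [huσ, huZ], by simpa using hF⟩
    omega
  have hsiphon := hσ.siphon (Y := {q | q ∈ N.places ∧ q ∉ Z}) (by
    rintro u hu q ⟨_, hqZ⟩ hF
    have hut := hσ.mem_transitions u hu
    obtain ⟨r, hr⟩ := R.exists_pre hut hF
    exact ⟨r, ⟨F_place_left hr hut, hZin u hu (fun huZ => hqZ (hZout u hu huZ q hF)) r hr⟩, hr⟩)
    (fun q hq => R.eq_zero q hq.1 (fun hqC => hq.2 ⟨q, hqC, .refl⟩))
  exact hsiphon.2 t htσ p ⟨F_place_left hp ht, hZin t htσ htZ p hp⟩ hp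

lemma exists_distLE (R : N.Regenerates μ₀ h C) {p t : α} (hp : p ∈ N.places) (hF : N.F p t) :
    ∃ n, N.DistLE {t | t ∈ N.transitions} C n p := by
  obtain ⟨c, hc, hpath⟩ := R.exists_path (F_transition_right hF hp) hF
  have key : ∀ x, Relation.ReflTransGen N.F x c →
      (x ∈ N.places → ∃ n, N.DistLE {t | t ∈ N.transitions} C n x) ∧
      (x ∈ N.transitions →
        ∃ q, N.F x q ∧ ∃ n, N.DistLE {t | t ∈ N.transitions} C n q) := by
    intro x hx
    induction hx using Relation.ReflTransGen.head_induction_on with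
    | refl => exact ⟨fun _ => ⟨0, hc⟩, fun hct =>
        absurd hct (Finset.disjoint_left.mp N.disj (R.subset_places c hc))⟩
    | @head x y hxy _ ih =>
      constructor
      · intro hx
        have hy := F_transition_right hxy hx
        obtain ⟨q, hq, n, hn⟩ := ih.2 hy
        exact ⟨n + 1, Or.inr ⟨y, hy, hxy, q, hq, hn⟩⟩
      · intro hx
        exact ⟨y, hxy, ih.1 (F_place_right hxy hx)⟩
  exact (key p (.head hF hpath)).1 hp

lemma distLE_congr (R : N.Regenerates μ₀ h C) {T : Set α} {p q t : α} (hp : p ∈ N.places)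
    (hpt : N.F p t) (hqt : N.F q t) {n : ℕ} (hn : N.DistLE T C n p) : N.DistLE T C n q := by
  cases n with
  | zero => exact (R.pre_iff p hn t hpt q).mp hqt
  | succ n =>
    rcases hn with hn | ⟨u, hu, hpu, r, hur, hr⟩
    · exact Or.inl ((R.pre_iff p hn t hpt q).mp hqt)
    · exact Or.inr ⟨u, hu, (R.pre_congr hp hpt hpu q).mp hqt, r, hur, hr⟩

lemma dist_congr (R : N.Regenerates μ₀ h C) {T : Set α} {p q t : α} (ht : t ∈ N.transitions)
    (hpt : N.F p t) (hqt : N.F q t) : N.dist T C p = N.dist T C q := by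
  unfold dist
  congr 1
  ext n
  exact ⟨R.distLE_congr (F_place_left hpt ht) hpt hqt, R.distLE_congr (F_place_left hqt ht) hqt hpt⟩

lemma eq_of_forall_mem_pre_empty {σ : List α} {ν : α → ℕ} (R : N.Regenerates μ₀ h C)
    (hσ : N.FireSeq μ σ ν) (hpre : ∀ t ∈ σ, ∀ p, ¬ N.F p t) : ν = μ := by
  funext p
  have h1 := hσ.add_countP p
  have h2 : σ.countP (fun t => N.F p t) = 0 := by
    simp only [List.countP_eq_zero, decide_eq_true_eq]
    exact fun t ht => hpre t ht p
  have h3 : σ.countP (fun t => N.F t p) = 0 := by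
    simp only [List.countP_eq_zero, decide_eq_true_eq]
    intro t ht hF
    obtain ⟨q, hq⟩ := R.exists_pre (hσ.mem_transitions t ht) hF
    exact hpre t ht q hq
  omega

/-- Unless an occurrence sequence consists of isolated transitions, some transition with an input
place is enabled where it starts. -/
lemma exists_enabled {σ : List α} {ν : α → ℕ} (R : N.Regenerates μ₀ h C)
    (hσ : N.FireSeq μ σ ν) : ν = μ ∨ ∃ t, N.Enabled μ t ∧ ∃ p, N.F p t := by
  by_cases hall : ∀ t ∈ σ, ∀ p, ¬ N.F p t
  · exact Or.inl (R.eq_of_forall_mem_pre_empty hσ hall)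
  · right
    induction hσ with
    | nil => simp at hall
    | @cons μ ν t σ he hs ih =>
      by_cases hp : ∃ p, N.F p t
      · exact ⟨t, he, hp⟩
      · push Not at hp
        have hfire : N.fire t μ = μ :=
          R.eq_of_forall_mem_pre_empty (.cons he (.nil _)) (by simpa using hp)
        rw [hfire] at ih
        exact ih (fun hσ => hall (List.forall_mem_cons.mpr ⟨hp, hσ⟩))

/-- If `C` can be reached from every place with an output transition by means of the transitions
in `T`, there is a choice of at most one transition of `T` for every cluster, and of none for the
transitions consuming from `C`, such that firing the chosen transitions leads
from every reachable marking to one that covers the home marking. -/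
lemma exists_allocation (R : N.Regenerates μ₀ h C) {T : Set α} (hT : T ⊆ {t | t ∈ N.transitions})
    (hpath : ∀ p ∈ N.places, ∀ t, N.F p t → ∃ n, N.DistLE T C n p) :
    ∃ A ⊆ T, (∀ t ∈ A, ∃ p, N.F p t) ∧ (∀ t ∈ A, ∀ p, N.F p t → p ∉ C) ∧
      (∀ t ∈ A, ∀ u ∈ A, ∀ p, N.F p t → N.F p u → t = u) ∧
      ∀ μ, N.Reach μ₀ μ → ∃ σ ν, N.FireSeq μ σ ν ∧ (∀ t ∈ σ, t ∈ A) ∧ h ≤ ν := by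
  set A₀ : Set α := {t | t ∈ T ∧ (∃ p, N.F p t) ∧ (∀ p, N.F p t → p ∉ C) ∧
    ∃ q, N.F t q ∧ ∀ p, N.F p t → N.dist T C q < N.dist T C p} with hA₀
  obtain ⟨A, hAA₀, hbij⟩ := Set.exists_subset_bijOn A₀ N.pre
  refine ⟨A, fun t ht => (hAA₀ ht).1, fun t ht => (hAA₀ ht).2.1, fun t ht => (hAA₀ ht).2.2.1,
    ?_, ?_⟩
  · intro t ht u hu p hpt hpu
    refine hbij.injOn ht hu (Set.ext fun q => ?_)
    exact R.pre_congr (F_place_left hpt (hT (hAA₀ ht).1)) hpt hpu q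
  · intro μ hμ
    obtain ⟨w, hw⟩ := exists_weight N (N.dist T C)
    obtain ⟨σ, ν, hσ, hσA, hν⟩ := R.bounded.exists_blocked A w
      (fun t ht => hw t (hT (hAA₀ ht).1) (hAA₀ ht).2.1 (hAA₀ ht).2.2.2) hμ
    refine ⟨σ, ν, hσ, hσA, ?_⟩
    have hrν : N.Reach μ₀ ν := hμ.trans ⟨σ, hσ⟩
    obtain ⟨τ, hτ⟩ := R.home ν hrν
    rcases R.exists_enabled hτ with heq | ⟨t, ht, p, hpt⟩
    · exact heq.le
    · have hp := F_place_left hpt ht.1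
      by_cases hpC : p ∈ C
      · exact R.le_of_forall_mem hrν
          (fun q hq => ht.2 q ((R.pre_iff p hpC t hpt q).mpr hq))
      · exfalso
        obtain ⟨u, hu, hpu, q, huq, -, hlt⟩ := exists_closer (hpath p hp t hpt) hpC
        have huA₀ : u ∈ A₀ := by
          refine ⟨hu, ⟨p, hpu⟩, fun r hr hrC => ?_, q, huq, fun r hr => ?_⟩
          · exact hpC ((R.pre_iff r hrC u hr p).mp hpu)
          · rwa [R.dist_congr (hT hu) hr hpu]
        obtain ⟨v, hv, hvu⟩ := hbij.surjOn ⟨u, huA₀, rfl⟩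
        refine hν v hv ⟨hT (hAA₀ hv).1, fun r hr => ht.2 r ?_⟩
        have hru : N.F r u := (Set.ext_iff.mp hvu r).mp hr
        exact (R.pre_congr hp hpu hpt r).mp hru

/-- A set of places whose transitions consume at most one token from it, that is
a siphon, meets `C` in a single place and can be left towards `C` only through itself, carries
exactly one token in every reachable marking. -/
lemma weight_eq_one (R : N.Regenerates μ₀ h C) {Q : Set α} {q₀ : α} (hq₀ : q₀ ∈ Q)
    (hq₀C : q₀ ∈ C) (hQC : ∀ q ∈ Q, q ∈ C → q = q₀)
    (huniq : ∀ t ∈ N.transitions, ∀ p ∈ Q, ∀ q ∈ Q, N.F p t → N.F q t → p = q)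
    (hsiphon : ∀ t ∈ N.transitions, ∀ p ∈ Q, N.F t p → ∃ q ∈ Q, N.F q t)
    (hdist : ∀ q ∈ Q, ∃ n,
      N.DistLE {t | t ∈ N.transitions ∧ ((∃ p ∈ Q, N.F p t) → ∃ p ∈ Q, N.F t p)} C n q)
    (hμ : N.Reach μ₀ μ) : N.weight (fun p => if p ∈ Q then 1 else 0) μ = 1 := by
  set T : Set α := {t | t ∈ N.transitions ∧ ((∃ p ∈ Q, N.F p t) → ∃ p ∈ Q, N.F t p)} with hTdef
  set w : α → ℕ := fun p => if p ∈ Q then 1 else 0 with hw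
  have hpath : ∀ p ∈ N.places, ∀ t, N.F p t → ∃ n, N.DistLE T C n p := by
    have key : ∀ n p, N.DistLE {t | t ∈ N.transitions} C n p → ∃ m, N.DistLE T C m p := by
      intro n
      induction n with
      | zero => exact fun p hp => ⟨0, hp⟩
      | succ n ih =>
        rintro p (hp | ⟨t, ht, hpt, q, htq, hq⟩)
        · exact ⟨0, hp⟩
        · by_cases htT : t ∈ T
          · obtain ⟨m, hm⟩ := ih q hq
            exact ⟨m + 1, Or.inr ⟨t, htT, hpt, q, htq, hm⟩⟩
          · have : ∃ r ∈ Q, N.F r t := by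
              by_contra hr
              exact htT ⟨ht, fun hr' => absurd hr' hr⟩
            obtain ⟨r, hrQ, hrt⟩ := this
            obtain ⟨m, hm⟩ := hdist r hrQ
            exact ⟨m, R.distLE_congr (F_place_left hrt ht) hrt hpt hm⟩
    intro p hp t hpt
    obtain ⟨n, hn⟩ := R.exists_distLE hp hpt
    exact key n p hn
  have hin : ∀ t ∈ T, N.weight w (fun p => if N.F p t then 1 else 0) ≤
      N.weight w (fun p => if N.F t p then 1 else 0) := by
    rintro t ⟨ht, htQ⟩
    by_cases hex : ∃ p ∈ Q, N.F p t
    · obtain ⟨p, hpQ, hpt⟩ := hex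
      obtain ⟨q, hqQ, htq⟩ := htQ ⟨p, hpQ, hpt⟩
      have h1 : N.weight w (fun p => if N.F p t then 1 else 0) = 1 := by
        unfold weight
        rw [Finset.sum_eq_single p]
        · simp [hw, hpQ, hpt]
        · intro r _ hrp
          by_cases hrQ : r ∈ Q
          · have : ¬ N.F r t := fun hrt => hrp (huniq t ht r hrQ p hpQ hrt hpt)
            simp [this]
          · simp [hw, hrQ]
        · exact fun hp => absurd (F_place_left hpt ht) hp
      have h2 := Finset.single_le_sum
          (f := fun p => w p * (if N.F t p then 1 else 0))
          (fun _ _ => Nat.zero_le _) (F_place_right htq ht)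
      simp only [hw, hqQ, htq, if_true, mul_one] at h2
      rw [h1]
      exact h2
    · push Not at hex
      have : N.weight w (fun p => if N.F p t then 1 else 0) = 0 := by
        refine Finset.sum_eq_zero fun p _ => ?_
        by_cases hpQ : p ∈ Q
        · simp [hex p hpQ]
        · simp [hw, hpQ]
      omega
  have hwh : N.weight w h = 1 := by
    unfold weight
    rw [Finset.sum_eq_single q₀]
    · simp [hw, hq₀, R.eq_one q₀ hq₀C]
    · intro p hp hne
      by_cases hpQ : p ∈ Q
      · simp [R.eq_zero p hp fun hpC => hne (hQC p hpQ hpC)]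
      · simp [hw, hpQ]
    · exact fun hn => absurd (R.subset_places q₀ hq₀C) hn
  have hpos : ∀ ν, N.Reach μ₀ ν → 1 ≤ N.weight w ν := by
    intro ν hν
    by_contra hlt
    have h0 : N.weight w ν = 0 := by omega
    obtain ⟨σ, hσ⟩ := R.home ν hν
    have := (hσ.siphon (Y := {q | q ∈ N.places ∧ q ∈ Q}) (by
      rintro t ht p ⟨_, hpQ⟩ htp
      have ht' := hσ.mem_transitions t ht
      obtain ⟨q, hqQ, hqt⟩ := hsiphon t ht' p hpQ htp
      exact ⟨q, ⟨F_place_left hqt ht', hqQ⟩, hqt⟩) (by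
      rintro p ⟨hp, hpQ⟩
      have := Finset.sum_eq_zero_iff.mp h0 p hp
      simpa [hw, hpQ] using this)).1 q₀ ⟨R.subset_places q₀ hq₀C, hq₀⟩
    rw [R.eq_one q₀ hq₀C] at this
    exact one_ne_zero this
  obtain ⟨A, hAT, -, -, -, hA⟩ := R.exists_allocation (fun t (ht : t ∈ T) => ht.1) hpath
  have honeh : ∀ ν, N.Reach h ν → N.weight w ν = 1 := by
    intro ν hν
    obtain ⟨σ, ξ, hσ, hσA, hle⟩ := hA ν (R.reach.trans hν)
    have hξ : ξ = h := R.bounded.eq_of_le R.reach (hν.trans ⟨σ, hσ⟩) hle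
    have h1 := hσ.weight_le w fun t ht => hin t (hAT (hσA t ht))
    have h2 := hpos ν (R.reach.trans hν)
    rw [hξ, hwh] at h1
    omega
  have hinv : ∀ t ∈ N.transitions, N.weight w (fun p => if N.F p t then 1 else 0) =
      N.weight w (fun p => if N.F t p then 1 else 0) := by
    intro t ht
    obtain ⟨ν, hν, he⟩ := R.live t ht h R.reach
    have h1 := he.weight_fire_add w
    have h2 := honeh _ hν
    have h3 := honeh _ (hν.trans he.reach_fire)
    omega
  obtain ⟨σ, hσ⟩ := R.home μ hμ
  rw [hσ.weight_eq w hinv, hwh]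

/-- Every place with an output transition lies in a set of places that meets `C` in a single
place and carries exactly one token in every reachable marking. -/
lemma exists_invariant (R : N.Regenerates μ₀ h C) {p t : α} (hp : p ∈ N.places)
    (hpt : N.F p t) : ∃ Q : Set α, p ∈ Q ∧ ∃ q₀ ∈ Q, q₀ ∈ C ∧ (∀ q ∈ Q, q ∈ C → q = q₀) ∧
      ∀ μ, N.Reach μ₀ μ → N.weight (fun p => if p ∈ Q then 1 else 0) μ = 1 := by
  obtain ⟨L, hpL, -, hinj, hstep⟩ := exists_short_path (R.exists_distLE hp hpt)
  have hrep : ∀ S : Set α, S.Nonempty → ∃ x ∈ S, (∃ y ∈ S, y ∈ L) → x ∈ L := by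
    rintro S ⟨x, hx⟩
    by_cases hS : ∃ y ∈ S, y ∈ L
    · obtain ⟨y, hy, hyL⟩ := hS
      exact ⟨y, hy, fun _ => hyL⟩
    · exact ⟨x, hx, fun hS' => absurd hS' hS⟩
  choose rep hrep hrepL using hrep
  have hexC : ∀ d, ∀ x ∈ L, N.dist {t | t ∈ N.transitions} C x = d → ∃ q ∈ L, q ∈ C := by
    intro d
    induction d using Nat.strong_induction_on with
    | _ d ih =>
      intro x hx hd
      rcases hstep x hx with hxC | ⟨u, _, _, r, hr, _, hlt⟩
      · exact ⟨x, hx, hxC⟩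
      · exact ih _ (hd ▸ hlt) r hr rfl
  obtain ⟨q₀, hq₀L, hq₀C⟩ := hexC _ p hpL rfl
  have hLC : ∀ x ∈ L, x ∈ C → x = q₀ := fun x hx hxC =>
    hinj x hx q₀ hq₀L (by rw [dist_eq_zero hxC, dist_eq_zero hq₀C])
  set B : α → α → Prop := fun x y =>
    ∃ t ∈ N.transitions, N.F t x ∧ ∃ hne : (N.pre t).Nonempty, y = rep (N.pre t) hne with hB
  set Q : Set α := {x | Relation.ReflTransGen B q₀ x} with hQ
  -- a path place in an input set is its representative
  have hrep_path : ∀ t ∈ N.transitions, ∀ x ∈ L, N.F x t → ∀ hne, rep (N.pre t) hne = x := by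
    intro t ht x hx hxt hne
    exact hinj _ (hrepL _ hne ⟨x, hxt, hx⟩) x hx (R.dist_congr ht (hrep _ hne) hxt)
  have hLQ : ∀ d, ∀ x ∈ L, N.dist {t | t ∈ N.transitions} C x = d → x ∈ Q := by
    intro d
    induction d using Nat.strong_induction_on with
    | _ d ih =>
      intro x hx hd
      rcases hstep x hx with hxC | ⟨u, hu, hxu, r, hr, hur, hlt⟩
      · rw [hLC x hx hxC]
        exact .refl
      · have hrQ := ih _ (hd ▸ hlt) r hr rfl
        exact .tail hrQ ⟨u, hu, hur, ⟨x, hxu⟩, (hrep_path u hu x hx hxu _).symm⟩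
  have hQrep : ∀ t ∈ N.transitions, ∀ q ∈ Q, N.F q t → ∀ hne, q = rep (N.pre t) hne := by
    intro t ht q hq hqt hne
    rcases Relation.ReflTransGen.cases_tail hq with rfl | ⟨r, _, u, hu, _, hne', rfl⟩
    · exact (hrep_path t ht q hq₀L hqt hne).symm
    · have hpre : N.pre u = N.pre t := Set.ext fun x =>
        R.pre_congr (F_place_left hqt ht) (hrep _ hne') hqt x
      simp only [hpre]
  have hQC : ∀ q ∈ Q, q ∈ C → q = q₀ := by
    intro q hq hqC
    rcases Relation.ReflTransGen.cases_tail hq with rfl | ⟨r, _, u, hu, _, hne, rfl⟩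
    · rfl
    · have hq₀u : N.F q₀ u := (R.pre_iff _ hqC u (hrep _ hne) q₀).mpr hq₀C
      exact hrep_path u hu q₀ hq₀L hq₀u hne
  refine ⟨Q, hLQ _ p hpL rfl, q₀, .refl, hq₀C, hQC, fun μ hμ => ?_⟩
  refine R.weight_eq_one (q₀ := q₀) .refl hq₀C hQC ?_ ?_ ?_ hμ
  · intro u hu x hx y hy hxu hyu
    rw [hQrep u hu x hx hxu ⟨x, hxu⟩, hQrep u hu y hy hyu ⟨x, hxu⟩]
  · intro u hu x hx hux
    obtain ⟨y, hyu⟩ := R.exists_pre hu hux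
    have hne : (N.pre u).Nonempty := ⟨y, hyu⟩
    exact ⟨rep _ hne, .tail hx ⟨u, hu, hux, hne, rfl⟩, hrep _ hne⟩
  · intro q hq
    induction hq with
    | refl => exact ⟨0, hq₀C⟩
    | @tail x y hx hxy ih =>
      obtain ⟨u, hu, hux, hne, rfl⟩ := hxy
      obtain ⟨n, hn⟩ := ih
      exact ⟨n + 1, Or.inr ⟨u, ⟨hu, fun _ => ⟨x, hx, hux⟩⟩, hrep _ hne, x, hux, hn⟩⟩

/-- Places with an output transition are safe. -/
lemma le_one (R : N.Regenerates μ₀ h C) {p t : α} (hp : p ∈ N.places) (hpt : N.F p t)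
    (hμ : N.Reach μ₀ μ) : μ p ≤ 1 := by
  obtain ⟨Q, hpQ, -, -, -, -, hone⟩ := R.exists_invariant hp hpt
  have := Finset.single_le_sum (f := fun p => (if p ∈ Q then 1 else 0) * μ p)
    (fun _ _ => Nat.zero_le _) hp
  simp only [hpQ, if_true, one_mul] at this
  exact this.trans (hone μ hμ).le

/-- The home marking is the only reachable marking that covers it. -/
lemma eq_of_le (R : N.Regenerates μ₀ h C) (hμ : N.Reach μ₀ μ) (hle : h ≤ μ) : μ = h := by
  obtain ⟨σ, hσ⟩ := R.home μ hμ
  funext p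
  by_cases hp : p ∈ N.places
  · by_cases hout : ∃ t, N.F p t
    · obtain ⟨t, hpt⟩ := hout
      obtain ⟨Q, hpQ, q₀, hq₀Q, hq₀C, hQC, hone⟩ := R.exists_invariant hp hpt
      have hone := hone μ hμ
      have h₀ : h q₀ ≤ μ q₀ := hle q₀
      rw [R.eq_one q₀ hq₀C] at h₀
      by_cases hpC : p ∈ C
      · have h1 := hle p
        rw [R.eq_one p hpC] at h1 ⊢
        exact le_antisymm (R.le_one hp hpt hμ) h1
      · rw [R.eq_zero p hp hpC]
        have hne : p ≠ q₀ := fun heq => hpC (heq ▸ hq₀C)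
        have hsub : ({p, q₀} : Finset α) ⊆ N.places := by
          intro x hx
          rcases Finset.mem_insert.mp hx with rfl | hx
          · exact hp
          · rw [Finset.mem_singleton.mp hx]
            exact R.subset_places q₀ hq₀C
        have := Finset.sum_le_sum_of_subset
          (f := fun p => (if p ∈ Q then 1 else 0) * μ p) hsub
        rw [Finset.sum_pair hne] at this
        simp only [hpQ, hq₀Q, if_true, one_mul] at this
        have := this.trans hone.le
        omega
    · push Not at hout
      have h1 := hσ.add_countP p
      have h2 : σ.countP (fun t => N.F p t) = 0 := by simp [hout]
      have : h p ≤ μ p := hle p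
      omega
  · exact (hσ.apply_eq_of_notMem hp).symm

/-- Two enabling-equivalent reachable markings from which the home marking is reached by
transitions of one and the same allocation: the first sequence fires no transition more often than
the second one. -/
lemma count_le [DecidableEq α] (R : N.Regenerates μ₀ h C) {A : Set α}
    (hpre : ∀ t ∈ A, ∃ p, N.F p t)
    (hAC : ∀ t ∈ A, ∀ p, N.F p t → p ∉ C)
    (huniq : ∀ t ∈ A, ∀ u ∈ A, ∀ p, N.F p t → N.F p u → t = u)
    {μ₁ μ₂ : α → ℕ} (hμ₁ : N.Reach μ₀ μ₁) (hen : N.en μ₁ ⊆ N.en μ₂)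
    {σ₁ σ₂ : List α} (hσ₁ : N.FireSeq μ₁ σ₁ h) (hσ₂ : N.FireSeq μ₂ σ₂ h)
    (hA₁ : ∀ t ∈ σ₁, t ∈ A) (hA₂ : ∀ t ∈ σ₂, t ∈ A) (t : α) : σ₁.count t ≤ σ₂.count t := by
  have hcount : ∀ τ : List α, (∀ u ∈ τ, u ∈ A) → ∀ u ∈ A, ∀ p, N.F p u →
      τ.countP (fun t => N.F p t) = τ.count u := by
    intro τ hτ u hu p hpu
    refine List.countP_congr fun v hv => ?_
    simp only [decide_eq_true_eq, beq_iff_eq]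
    exact ⟨fun hpv => huniq v (hτ v hv) u hu p hpv hpu, fun hvu => hvu ▸ hpu⟩
  suffices ∀ τ, τ <+: σ₁ → ∀ t, τ.count t ≤ σ₂.count t from this σ₁ (List.prefix_refl _) t
  intro τ
  induction τ using List.reverseRecOn with
  | nil => simp
  | append_singleton τ u ih =>
    intro hτ v
    have hle := ih ((List.prefix_append τ [u]).trans hτ)
    by_cases huv : u = v
    swap
    · simpa [huv] using hle v
    subst huv
    by_contra! hlt
    obtain ⟨ρ, rfl⟩ := hτ
    rw [List.append_assoc] at hσ₁
    obtain ⟨ν, hν, hρ⟩ := hσ₁.exists_of_append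
    have hνu : N.Enabled ν u := by
      cases hρ with
      | cons he _ => exact he
    have huA : u ∈ A := hA₁ u (by simp)
    have hτA : ∀ t ∈ τ, t ∈ A := fun t ht => hA₁ t (by simp [ht])
    have key : ∀ p, N.F p u → μ₂ p + 1 ≤ μ₁ p := by
      intro p hpu
      have h1 := hν.add_countP p
      have h2 := hσ₂.add_countP p
      rw [hcount τ hτA u huA p hpu] at h1
      rw [hcount σ₂ hA₂ u huA p hpu, R.eq_zero p (F_place_left hpu hνu.1) (hAC u huA p hpu)] at h2
      have h3 : τ.countP (fun t => N.F t p) ≤ σ₂.countP (fun t => N.F t p) := by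
        have : (τ : Multiset α) ≤ σ₂ := Multiset.le_iff_count.mpr fun t => by simpa using hle t
        exact (Multiset.coe_le.mp this).countP_le _
      have h4 := hνu.2 p hpu
      simp only [List.count_append, List.count_singleton_self] at hlt
      omega
    obtain ⟨p, hpu⟩ := hpre u huA
    have h₂ : N.Enabled μ₂ u :=
      hen (show N.Enabled μ₁ u from ⟨hνu.1, fun q hq => by have := key q hq; omega⟩)
    have h1 := key p hpu
    have h2 := h₂.2 p hpu
    have h3 := R.le_one (F_place_left hpu hνu.1) hpu hμ₁
    omega

lemma lucent (R : N.Regenerates μ₀ h C) : N.Lucent μ₀ := by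
  intro μ₁ μ₂ hμ₁ hμ₂ hen p _
  obtain ⟨A, -, hpre, hAC, huniq, hA⟩ :=
    R.exists_allocation Set.Subset.rfl fun p hp t hpt => R.exists_distLE hp hpt
  have hhome : ∀ μ, N.Reach μ₀ μ → ∃ σ, N.FireSeq μ σ h ∧ ∀ t ∈ σ, t ∈ A := by
    intro μ hμ
    obtain ⟨σ, ν, hσ, hσA, hle⟩ := hA μ hμ
    obtain rfl := R.eq_of_le (hμ.trans ⟨σ, hσ⟩) hle
    exact ⟨σ, hσ, hσA⟩
  obtain ⟨σ₁, hσ₁, hA₁⟩ := hhome μ₁ hμ₁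
  obtain ⟨σ₂, hσ₂, hA₂⟩ := hhome μ₂ hμ₂
  have hperm : σ₁.Perm σ₂ := List.perm_iff_count.mpr fun t => le_antisymm
    (R.count_le hpre hAC huniq hμ₁ hen.subset hσ₁ hσ₂ hA₁ hA₂ t)
    (R.count_le hpre hAC huniq hμ₂ hen.symm.subset hσ₂ hσ₁ hA₂ hA₁ t)
  have h1 := hσ₁.add_countP p
  have h2 := hσ₂.add_countP p
  rw [hperm.countP_eq, hperm.countP_eq] at h1
  omega

end Regenerates

/-- All transitions consuming from a cluster of a free-choice net have the places of the cluster
as their input set. -/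
lemma FreeChoice.pre_iff_mem_cluster {α : Type*} [DecidableEq α] {N : Net α}
    (hfc : N.FreeChoice) {cl : Set α} (hcl : N.IsCluster cl) {p t : α} (hp : p ∈ cl) (hpP : p ∈ N.places) (hpt : N.F p t) (q : α) :
    N.F q t ↔ q ∈ cl ∧ q ∈ N.places := by
  obtain ⟨x, -, rfl⟩ := hcl
  have ht := F_transition_right hpt hpP
  have htcl : t ∈ N.clusterOf x := fun S hS => hS.2.1 p (hp S hS) hpP t hpt
  refine ⟨fun hqt => ⟨fun S hS => hS.2.2 t (htcl S hS) ht q hqt, F_place_left hqt ht⟩, ?_⟩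
  rintro ⟨hq, hqP⟩
  -- the places and transitions sharing the input set of `t`
  set S : Set α := {y | N.F y t ∨ N.F p y} with hS
  have hST : ∀ y, y ∈ N.transitions → (y ∈ S ↔ N.F p y) := fun y hy =>
    ⟨fun h => h.resolve_left fun hyt =>
      Finset.disjoint_left.mp N.disj (F_place_left hyt ht) hy, Or.inr⟩
  have hSP : ∀ y, y ∈ N.places → (y ∈ S ↔ N.F y t) := fun y hy =>
    ⟨fun h => h.resolve_right fun hpy =>
      Finset.disjoint_left.mp N.disj hy (F_transition_right hpy hpP), Or.inl⟩
  have hiff : ∀ y u, N.F y u → u ∈ N.transitions → (y ∈ S ↔ u ∈ S) := by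
    intro y u hyu hu
    have hy := F_place_left hyu hu
    rw [hST u hu, hSP y hy]
    exact ⟨fun hyt => hfc y hy t hyt p hpt u hyu, fun hpu => hfc p hpP u hpu y hyu t hpt⟩
  by_cases hx : x ∈ S
  · exact (hSP q hqP).mp (hq S ⟨hx, fun y hy hyP u hyu =>
      (hiff y u hyu (F_transition_right hyu hyP)).mp hy,
      fun u hu huT y hyu => (hiff y u hyu huT).mpr hu⟩)
  · exact absurd ((hSP p hpP).mpr hpt) (hp Sᶜ ⟨hx, fun y hy hyP u hyu hu =>
      hy ((hiff y u hyu (F_transition_right hyu hyP)).mpr hu),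
      fun u hu huT y hyu hy => hu ((hiff y u hyu huT).mp hy)⟩)

lemma Perpetual.exists_regenerates {α : Type*} [DecidableEq α] {N : Net α} {μ₀ : α → ℕ}
    {cl : Set α} (hfc : N.FreeChoice) (hperp : N.Perpetual μ₀ cl) :
    ∃ h, N.Regenerates μ₀ h {p | p ∈ cl ∧ p ∈ N.places} := by
  obtain ⟨hlive, hbdd, hcl, hhome⟩ := hperp
  set h : α → ℕ := fun p => if p ∈ N.places then N.clusterMarking cl p else μ₀ p with hh
  have home : ∀ μ, N.Reach μ₀ μ → N.Reach μ h := by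
    rintro μ ⟨σ, hσ⟩
    obtain ⟨ν, ⟨τ, hτ⟩, hν⟩ := hhome μ ⟨σ, hσ⟩
    refine ⟨τ, ?_⟩
    convert hτ using 1
    funext p
    by_cases hp : p ∈ N.places
    · simp [hh, hp, hν p hp]
    · simp [hh, hp, (hσ.append hτ).apply_eq_of_notMem hp]
  exact ⟨h, {
    freeChoice := hfc
    live := hlive
    bounded := hbdd
    reach := home μ₀ (.refl μ₀)
    home := home
    subset_places := fun p hp => hp.2
    eq_one := fun p hp => by simp [hh, clusterMarking, hp.1, hp.2]
    eq_zero := fun p hp hpC => by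
      have : p ∉ cl := fun hpcl => hpC ⟨hpcl, hp⟩
      simp [hh, clusterMarking, hp, this]
    pre_iff := fun p hp t hpt q => hfc.pre_iff_mem_cluster hcl hp.1 hp.2 hpt q }⟩

end Net

/-- **Van der Aalst's theorem.** Every perpetual free-choice system is lucent:
if `(N, μ₀)` is a live and bounded free-choice system with a cluster `cl` whose
marking `μ_cl` is a home marking, then any two reachable markings enabling the
same transitions are equal. -/
theorem vanDerAalst_perpetual_freeChoice_lucent
    {α : Type*} [DecidableEq α] (N : Net α) (μ₀ : α → ℕ) (cl : Set α)
    (hfc : N.FreeChoice) (hperp : N.Perpetual μ₀ cl) :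
    N.Lucent μ₀ := by
  obtain ⟨h, R⟩ := Net.Perpetual.exists_regenerates hfc hperp
  exact R.lucent
end

section
/- Token-free enabling paths in T-systems: let (TN,μ) be a live T-system, let t be a transition of TN and q ∈ •t a pre-place of t with μ(q) = 0. Then there exist a transition τ enabled at μ and an elementary path δ = (τ,…,q,t) of TN ending in the edge (q,t) such that the token count of δ at μ is zero, ‖μ‖_δ = 0. -/
open Classical

namespace Net

theorem FireSeq.concat {α : Type*} {N : Net α} {μ ν : α → ℕ} {σ : List α} {t : α}
    (h : N.FireSeq μ σ ν) (ht : N.Enabled ν t) :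
    N.FireSeq μ (σ ++ [t]) (N.fire t ν) := by
  induction h with
  | nil μ => exact .cons ht (.nil _)
  | cons hu _ ih => exact .cons hu (ih ht)

/-- If `s` is the only transition feeding the unmarked place `q`, then `s` fires
before any transition consuming from `q` does. -/
theorem FireSeq.idxOf_lt_idxOf {α : Type*} [DecidableEq α] {N : Net α} {μ ν : α → ℕ}
    {σ : List α} {q s t : α} (h : N.FireSeq μ σ ν) (hqt : N.F q t)
    (hs : ∀ u, N.F u q → u = s) (hq : μ q = 0) (ht : t ∈ σ) :
    σ.idxOf s < σ.idxOf t := by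
  induction h with
  | nil μ => simp at ht
  | @cons μ ν u σ hu _ ih =>
    have hut : u ≠ t := by
      rintro rfl
      have := hu.2 q hqt
      omega
    rw [List.idxOf_cons_ne _ hut]
    by_cases hus : u = s
    · simp [hus]
    · rw [List.idxOf_cons_ne _ hus]
      have hF : ¬ N.F u q := fun h => hus (hs u h)
      have hmem : t ∈ σ := (List.mem_cons.mp ht).resolve_left (Ne.symm hut)
      exact Nat.succ_lt_succ (ih (by simp [fire, hq, hF]) hmem)

theorem F.mem_nodes {α : Type*} [DecidableEq α] {N : Net α} {x y : α} (h : N.F x y) :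
    x ∈ N.nodes ∧ y ∈ N.nodes := by
  rcases N.edges x y h with ⟨hx, hy⟩ | ⟨hx, hy⟩ <;> simp [nodes, hx, hy]

theorem F.mem_places {α : Type*} {N : Net α} {q t : α} (h : N.F q t)
    (ht : t ∈ N.transitions) : q ∈ N.places := by
  rcases N.edges q t h with ⟨hq, _⟩ | ⟨_, hp⟩
  · exact hq
  · exact absurd ht (Finset.disjoint_left.mp N.disj hp)

theorem F.mem_transitions {α : Type*} {N : Net α} {s q : α} (h : N.F s q)
    (hq : q ∈ N.places) : s ∈ N.transitions := by
  rcases N.edges s q h with ⟨_, hp⟩ | ⟨hs, _⟩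
  · exact absurd hp (Finset.disjoint_left.mp N.disj hq)
  · exact hs

/-- An elementary path from a transition enabled at `μ` to `t`, all of whose places are
unmarked, and whose transitions, as well as the consumers of its places, first occur in
`σ` no later than `t`. -/
structure IsEnablingPath {α : Type*} [DecidableEq α] (N : Net α) (μ : α → ℕ) (σ : List α)
    (t : α) (δ : List α) : Prop where
  head_enabled : ∃ τ, N.Enabled μ τ ∧ δ.head? = some τ
  getLast_eq : δ.getLast? = some t
  isPath : N.IsPath δ
  nodup : δ.Nodup
  unmarked : ∀ p ∈ δ, p ∈ N.places → μ p = 0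
  transition_le : ∀ x ∈ δ, x ∈ N.transitions → σ.idxOf x ≤ σ.idxOf t
  place_le : ∀ p ∈ δ, p ∈ N.places → ∀ u, N.F p u → σ.idxOf u ≤ σ.idxOf t

theorem isEnablingPath_singleton {α : Type*} [DecidableEq α] {N : Net α} {μ : α → ℕ}
    (σ : List α) {t : α} (ht : N.Enabled μ t) : N.IsEnablingPath μ σ t [t] where
  head_enabled := ⟨t, ht, rfl⟩
  getLast_eq := rfl
  isPath := ⟨by simp, by simp [nodes, ht.1], List.isChain_singleton t⟩
  nodup := List.nodup_singleton t
  unmarked p hp hpl := by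
    rw [List.mem_singleton.mp hp] at hpl
    exact absurd ht.1 (Finset.disjoint_left.mp N.disj hpl)
  transition_le x hx _ := by rw [List.mem_singleton.mp hx]
  place_le p hp hpl := by
    rw [List.mem_singleton.mp hp] at hpl
    exact absurd ht.1 (Finset.disjoint_left.mp N.disj hpl)

theorem IsEnablingPath.append {α : Type*} [DecidableEq α] {N : Net α} {μ : α → ℕ}
    {σ δ : List α} {s q t : α} (hT : N.IsTNet) (h : N.IsEnablingPath μ σ s δ)
    (ht : t ∈ N.transitions) (hsq : N.F s q) (hqt : N.F q t) (hq : μ q = 0)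
    (hlt : σ.idxOf s < σ.idxOf t) : N.IsEnablingPath μ σ t (δ ++ [q, t]) := by
  have hqp : q ∈ N.places := hqt.mem_places ht
  have htp : t ∉ N.places := fun hp => Finset.disjoint_left.mp N.disj hp ht
  have hqδ : q ∉ δ := fun hmem => by
    have := h.place_le q hmem hqp t hqt
    omega
  have htδ : t ∉ δ := fun hmem => by
    have := h.transition_le t hmem ht
    omega
  have hqT : q ∉ N.transitions := Finset.disjoint_left.mp N.disj hqp
  refine ⟨?_, by simp, ⟨by simp, ?_, ?_⟩, ?_, ?_, ?_, ?_⟩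
  · obtain ⟨τ, hτ, hhead⟩ := h.head_enabled
    exact ⟨τ, hτ, by simp [List.head?_append, hhead]⟩
  · intro x hx
    simp only [List.mem_append, List.mem_cons, List.not_mem_nil, or_false] at hx
    rcases hx with hx | rfl | rfl
    · exact h.isPath.2.1 x hx
    · exact hqt.mem_nodes.1
    · exact hqt.mem_nodes.2
  · refine List.IsChain.append h.isPath.2.2 (by simpa using hqt) ?_
    simpa [h.getLast_eq] using hsq
  · have hne : q ≠ t := fun he => htp (he ▸ hqp)
    rw [List.nodup_append]
    refine ⟨h.nodup, by simp [hne], ?_⟩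
    intro a ha b hb
    simp only [List.mem_cons, List.not_mem_nil, or_false] at hb
    rcases hb with rfl | rfl
    · exact fun he => hqδ (he ▸ ha)
    · exact fun he => htδ (he ▸ ha)
  · intro x hx hxp
    simp only [List.mem_append, List.mem_cons, List.not_mem_nil, or_false] at hx
    rcases hx with hx | rfl | rfl
    · exact h.unmarked x hx hxp
    · exact hq
    · exact absurd hxp htp
  · intro x hx hxT
    simp only [List.mem_append, List.mem_cons, List.not_mem_nil, or_false] at hx
    rcases hx with hx | rfl | rfl
    · exact (h.transition_le x hx hxT).trans hlt.le
    · exact absurd hxT hqT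
    · exact le_rfl
  · intro x hx hxp u hu
    simp only [List.mem_append, List.mem_cons, List.not_mem_nil, or_false] at hx
    rcases hx with hx | rfl | rfl
    · exact (h.place_le x hx hxp u hu).trans hlt.le
    · rw [(hT x hqp).2.unique hu hqt]
    · exact absurd hxp htp

theorem FireSeq.exists_feeder {α : Type*} [DecidableEq α] {N : Net α} {μ ν : α → ℕ}
    {σ : List α} {q t : α} (hT : N.IsTNet) (h : N.FireSeq μ σ ν) (ht : t ∈ N.transitions)
    (htσ : t ∈ σ) (hqt : N.F q t) (hq : μ q = 0) :
    ∃ s ∈ N.transitions, N.F s q ∧ s ∈ σ ∧ σ.idxOf s < σ.idxOf t := by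
  have hqp : q ∈ N.places := hqt.mem_places ht
  obtain ⟨s, hs, huniq⟩ := (hT q hqp).1
  have hlt := h.idxOf_lt_idxOf hqt huniq hq htσ
  exact ⟨s, hs.mem_transitions hqp, hs,
    List.idxOf_lt_length_iff.mp (hlt.trans (List.idxOf_lt_length_iff.mpr htσ)), hlt⟩

theorem FireSeq.exists_isEnablingPath {α : Type*} [DecidableEq α] {N : Net α}
    {μ ν : α → ℕ} {σ : List α} (hT : N.IsTNet) (h : N.FireSeq μ σ ν) {t : α}
    (ht : t ∈ N.transitions) (htσ : t ∈ σ) : ∃ δ, N.IsEnablingPath μ σ t δ := by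
  induction hn : σ.idxOf t using Nat.strong_induction_on generalizing t with
  | _ n ih =>
    by_cases hen : N.Enabled μ t
    · exact ⟨[t], isEnablingPath_singleton σ hen⟩
    · obtain ⟨q, hqt, hq⟩ : ∃ q, N.F q t ∧ μ q = 0 := by
        by_contra! hcon
        exact hen ⟨ht, fun p hp => Nat.one_le_iff_ne_zero.mpr (hcon p hp)⟩
      obtain ⟨s, hs, hsq, hsσ, hlt⟩ := h.exists_feeder hT ht htσ hqt hq
      obtain ⟨δ, hδ⟩ := ih _ (hn ▸ hlt) hs hsσ rfl
      exact ⟨_, hδ.append hT ht hsq hqt hq hlt⟩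

end Net

/-- **Token-free enabling paths in live T-systems.** If `(TN, μ)` is a live
T-system, `t` a transition and `q ∈ •t` a pre-place with `μ q = 0`, then there
is a transition `τ` enabled at `μ` and an elementary path `δ = (τ, …, q, t)`
ending in the edge `(q, t)` with token count `‖μ‖_δ = 0`. -/
theorem tSystem_exists_tokenFree_enabling_path
    {α : Type*} [DecidableEq α] (TN : Net α) (μ : α → ℕ)
    (hT : TN.IsTNet) (hlive : TN.Live μ)
    (t q : α) (ht : t ∈ TN.transitions) (hq : TN.F q t) (hq0 : μ q = 0) :
    ∃ (τ : α) (δ δ₀ : List α),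
      TN.Enabled μ τ ∧ δ = δ₀ ++ [q, t] ∧ δ.head? = some τ ∧
      TN.IsPath δ ∧ δ.Nodup ∧ TN.tokenCount μ δ.toFinset = 0 := by
  obtain ⟨ν, ⟨σ, hσ⟩, hν⟩ := hlive t ht μ ⟨[], .nil μ⟩
  have hfire := hσ.concat hν
  obtain ⟨s, hs, hsq, hsσ, hlt⟩ := hfire.exists_feeder hT ht (by simp) hq hq0
  obtain ⟨δ, hδ⟩ := hfire.exists_isEnablingPath hT hs hsσ
  have hext := hδ.append hT ht hsq hq hq0 hlt
  obtain ⟨τ, hτ, hhead⟩ := hext.head_enabled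
  refine ⟨τ, _, δ, hτ, rfl, hhead, hext.isPath, hext.nodup, Finset.sum_eq_zero fun p hp => ?_⟩
  rw [Finset.mem_inter, List.mem_toFinset] at hp
  exact hext.unmarked p hp.1 hp.2
end

section
/- Adapted CP-subnets are acyclic: let (N,μ₀) be a perpetual free-choice system with regeneration cluster cl, and let N̂ ⊆ N be a cl-adapted CP-subnet. Then N̂ contains no circuit; in particular every path in N̂ is elementary. -/
open Classical

namespace Net

/-- If every node of `C` has a successor in `C`, and the places of `C` have no
other successor, then a marked place of `C` persists along occurrence
sequences. -/
theorem FireSeq.exists_marked {α : Type*} {N : Net α} {C : Set α}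
    (hC : ∀ x ∈ C, ∃ y ∈ C, N.F x y)
    (huniq : ∀ p ∈ C, p ∈ N.places → ∀ t t', N.F p t → N.F p t' → t = t')
    {μ ν : α → ℕ} {σ : List α} (h : N.FireSeq μ σ ν)
    (hμ : ∃ p ∈ C, p ∈ N.places ∧ 1 ≤ μ p) : ∃ p ∈ C, p ∈ N.places ∧ 1 ≤ ν p := by
  induction h with
  | nil => exact hμ
  | @cons μ ν t σ hen _ ih =>
    refine ih ?_
    obtain ⟨p, hpC, hp, hpμ⟩ := hμ
    by_cases hpt : N.F p t
    · obtain ⟨y, hyC, hpy⟩ := hC p hpC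
      obtain rfl := huniq p hpC hp t y hpt hpy
      obtain ⟨q, hqC, htq⟩ := hC t hyC
      have hq : q ∈ N.places := by
        rcases N.edges t q htq with ⟨h1, _⟩ | ⟨_, h2⟩
        · exact absurd hen.1 (Finset.disjoint_left.mp N.disj h1)
        · exact h2
      refine ⟨q, hqC, hq, ?_⟩
      simp only [fire, if_pos htq]
      omega
    · refine ⟨p, hpC, hp, ?_⟩
      simp only [fire, if_neg hpt]
      omega

/-- In a free-choice net, a cluster containing a place `p` with a single
post-transition `t` consists of `t` and its pre-set. -/
theorem IsCluster.subset_of_unique_post {α : Type*} [DecidableEq α] {N : Net α}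
    (hfc : N.FreeChoice) {cl : Set α}
    (hcl : N.IsCluster cl) {p t : α} (hpcl : p ∈ cl) (hp : p ∈ N.places) (hpt : N.F p t)
    (huniq : ∀ t', N.F p t' → t' = t) : cl ⊆ insert t {q | N.F q t} := by
  obtain ⟨x, -, rfl⟩ := hcl
  have place_of_edge : ∀ {a b}, b ∈ N.transitions → N.F a b → a ∈ N.places := by
    intro a b hb hab
    rcases N.edges a b hab with ⟨h1, _⟩ | ⟨_, h2⟩
    · exact h1
    · exact absurd hb (Finset.disjoint_left.mp N.disj h2)
  have ht : t ∈ N.transitions := by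
    rcases N.edges p t hpt with ⟨_, h1⟩ | ⟨h2, _⟩
    · exact h1
    · exact absurd h2 (Finset.disjoint_left.mp N.disj hp)
  have post_eq : ∀ q, N.F q t → ∀ t', N.F q t' → t' = t := fun q hqt t' hqt' =>
    huniq t' (hfc q (place_of_edge ht hqt) t hqt p hpt t' hqt')
  have hx : x ∈ insert t {q | N.F q t} := by
    by_contra hx
    refine hpcl (insert t {q | N.F q t})ᶜ ⟨hx, ?_, ?_⟩ (Or.inr hpt)
    · rintro q hq hqp t' hqt' (rfl | ht't)
      · exact hq (Or.inr hqt')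
      · rcases N.edges q t' hqt' with ⟨_, h1⟩ | ⟨h2, _⟩
        · exact Finset.disjoint_left.mp N.disj (place_of_edge ht ht't) h1
        · exact Finset.disjoint_left.mp N.disj hqp h2
    · rintro t' ht' ht't q hqt' (rfl | hqt)
      · exact Finset.disjoint_left.mp N.disj (place_of_edge ht't hqt') ht
      · exact ht' (Or.inl (post_eq q hqt t' hqt'))
  refine Set.sInter_subset_of_mem ⟨hx, ?_, ?_⟩
  · rintro q (rfl | hqt) hqp t' hqt'
    · exact absurd ht (Finset.disjoint_left.mp N.disj hqp)
    · exact Or.inl (post_eq q hqt t' hqt')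
  · rintro t' (rfl | ht't) ht' q hqt'
    · exact Or.inr hqt'
    · exact absurd ht' (Finset.disjoint_left.mp N.disj (place_of_edge ht ht't))

/-- No nonempty set of nodes of an adapted CP-subnet has a successor within
itself for each of its nodes. -/
theorem IsCPSubnet.eq_empty_of_forall_exists_succ {α : Type*} [DecidableEq α] {N : Net α}
    {μ₀ : α → ℕ} {cl : Set α}
    (hfc : N.FreeChoice) (hperp : N.Perpetual μ₀ cl) {S : Finset α}
    (hS : N.IsCPSubnet S) (had : ¬ cl ⊆ (S : Set α)) {C : Set α} (hCS : C ⊆ S)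
    (hC : ∀ x ∈ C, ∃ y ∈ C, N.F x y) : C = ∅ := by
  obtain ⟨hlive, -, hcl, hhome⟩ := hperp
  obtain ⟨-, -, -, hbord, htnet, ⟨u, hu⟩, hconn⟩ := hS
  have huniq : ∀ p ∈ S, p ∈ N.places → ∀ t t', N.F p t → N.F p t' → t = t' :=
    fun p hpS hp t t' ht ht' => (htnet p hpS hp).2.unique
      ⟨hbord p hpS hp t (Or.inr ht), ht⟩ ⟨hbord p hpS hp t' (Or.inr ht'), ht'⟩
  by_contra hne
  obtain ⟨p, hpC, hp⟩ : ∃ p ∈ C, p ∈ N.places := by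
    obtain ⟨x, hxC⟩ := Set.nonempty_iff_ne_empty.mpr hne
    obtain ⟨y, hyC, hxy⟩ := hC x hxC
    rcases N.edges x y hxy with ⟨h, _⟩ | ⟨_, h⟩
    · exact ⟨x, hxC, h⟩
    · exact ⟨y, hyC, h⟩
  obtain ⟨p, hpC, hp, hpcl⟩ : ∃ p ∈ C, p ∈ N.places ∧ p ∈ cl := by
    obtain ⟨t, -, hpt⟩ := hC p hpC
    have ht : t ∈ N.transitions := by
      rcases N.edges p t hpt with ⟨_, h1⟩ | ⟨h2, _⟩
      · exact h1
      · exact absurd h2 (Finset.disjoint_left.mp N.disj hp)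
    obtain ⟨μ, hμ, hen⟩ := hlive t ht μ₀ ⟨[], .nil μ₀⟩
    obtain ⟨ν, ⟨σ, hσ⟩, hν⟩ := hhome μ hμ
    obtain ⟨q, hqC, hq, hqν⟩ := hσ.exists_marked hC (fun p hp => huniq p (hCS hp))
      ⟨p, hpC, hp, hen.2 p hpt⟩
    refine ⟨q, hqC, hq, ?_⟩
    by_contra hqcl
    simp [hν q hq, clusterMarking, hqcl] at hqν
  obtain ⟨t, htC, hpt⟩ := hC p hpC
  have hsub := hcl.subset_of_unique_post hfc hpcl hp hpt
    (fun t' ht' => huniq p (hCS hpC) hp t' t ht' hpt)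
  obtain ⟨q, hqcl, hqS⟩ := Set.not_subset.mp had
  rcases hsub hqcl with rfl | hqt
  · exact hqS (hCS htC)
  change N.F q t at hqt
  have hq : q ∈ N.places := by
    rcases N.edges q t hqt with ⟨h1, _⟩ | ⟨_, h2⟩
    · exact h1
    · rcases N.edges p t hpt with ⟨_, h3⟩ | ⟨h4, _⟩
      · exact absurd h3 (Finset.disjoint_left.mp N.disj h2)
      · exact absurd h4 (Finset.disjoint_left.mp N.disj hp)
  obtain ⟨hu, hut⟩ := Finset.mem_inter.mp hu
  have hreach := hconn q (Finset.mem_sdiff.mpr ⟨Finset.mem_union_left _ hq, hqS⟩) u hu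
  rcases hreach.cases_head with rfl | ⟨c, ⟨_, hc, hqc⟩, _⟩
  · exact Finset.disjoint_left.mp N.disj hq hut
  · obtain rfl := huniq p (hCS hpC) hp t c hpt (hfc q hq t hqt p hpt c hqc)
    exact (Finset.mem_sdiff.mp hc).2 (hCS htC)

end Net

/-- **Adapted CP-subnets are acyclic.** Let `(N, μ₀)` be a perpetual
free-choice system with regeneration cluster `cl` and let `S` span a
`cl`-adapted CP-subnet. Then the subnet contains no circuit; in particular
every path inside the subnet is elementary. -/
theorem adapted_cpSubnet_acyclic
    {α : Type*} [DecidableEq α] (N : Net α) (μ₀ : α → ℕ) (cl : Set α)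
    (hfc : N.FreeChoice) (hperp : N.Perpetual μ₀ cl)
    (S : Finset α) (hS : N.IsCPSubnet S) (had : ¬ cl ⊆ (S : Set α)) :
    (¬ ∃ γ : List α, N.IsCircuit γ ∧ ∀ x ∈ γ, x ∈ S) ∧
    (∀ δ : List α, N.IsPath δ → (∀ x ∈ δ, x ∈ S) → δ.Nodup) := by
  constructor
  · rintro ⟨γ, ⟨⟨hne, -, hchain⟩, _, hclose⟩, hγS⟩
    have hempty := hS.eq_empty_of_forall_exists_succ hfc hperp had
      (C := {x | x ∈ γ}) hγS (by
        intro x hx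
        obtain ⟨k, hk, rfl⟩ := List.mem_iff_getElem.mp hx
        by_cases hk' : k + 1 < γ.length
        · exact ⟨γ[k + 1], List.getElem_mem _, List.isChain_iff_getElem.mp hchain k hk'⟩
        · refine ⟨γ.head hne, List.head_mem hne, ?_⟩
          rw [List.getLast_eq_getElem] at hclose
          have hlast : γ.length - 1 = k := by omega
          simpa only [hlast] using hclose)
    exact (Set.eq_empty_iff_forall_notMem.mp hempty) _ (List.head_mem hne)
  · rintro δ ⟨-, -, hchain⟩ hδS
    rw [List.nodup_iff_pairwise_ne, List.pairwise_iff_getElem]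
    intro i j hi hj hij heq
    have hempty := hS.eq_empty_of_forall_exists_succ hfc hperp had
      (C := {x | ∃ k, ∃ hk : k < δ.length, i ≤ k ∧ k < j ∧ δ[k] = x})
      (by rintro _ ⟨k, hk, -, -, rfl⟩; exact hδS _ (List.getElem_mem _)) (by
        rintro _ ⟨k, hk, hik, hkj, rfl⟩
        have hstep := List.isChain_iff_getElem.mp hchain k (by omega)
        refine ⟨_, ?_, hstep⟩
        rcases Nat.lt_or_ge (k + 1) j with hlt | hge
        · exact ⟨k + 1, by omega, by omega, hlt, rfl⟩
        · obtain rfl : j = k + 1 := by omega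
          exact ⟨i, hi, le_rfl, hij, heq⟩)
    exact (Set.eq_empty_iff_forall_notMem.mp hempty) _ ⟨i, hi, le_rfl, hij, rfl⟩
end
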